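/- Norm identity for the projected commutator vector: for every integer l ≥ 0, ‖P g_l‖²_{L²(S¹)} = Σ_{(n, m, n', m') ∈ Γ_l} 2^{-(n + n' + m + m')/4}, where Γ_l := {(n, m, n', m') ∈ ℕ⁴ : 2^m ≥ l + 1, 2^{m'} ≥ l + 1, 2^n ≥ 2^m − l, 2^{n'} ≥ 2^{m'} − l, and 2^n − 2^m = 2^{n'} − 2^{m'}}, the sum converging absolutely. -/

import Mathlib

open MeasureTheory

noncomputable section

instance : Fact (0 < 2 * Real.pi) := ⟨by positivity⟩

/-- `L²(S¹)`: the circle of circumference `2π` with its normalized arc-length (Haar)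
measure. Its orthonormal Fourier basis is `e_l = fourierLp 2 l`, `l ∈ ℤ`. -/
abbrev CircleL2 : Type := Lp ℂ 2 (@AddCircle.haarAddCircle (2 * Real.pi) _)

/-- The continuous real-valued Weierstrass-type function
`W(ζ) = Σ_{n≥0} 2^{-n/4}(ζ^{2^n} + ζ^{-2^n})`, as a continuous function on the circle
(the series converges uniformly, i.e. in `C(S¹, ℂ)`). -/
def Wfun : C(AddCircle (2 * Real.pi), ℂ) :=
  ∑' n : ℕ, (((2 : ℝ) ^ (-(n : ℝ) / 4) : ℝ) : ℂ) • (fourier (2 ^ n) + fourier (-(2 ^ n : ℤ)))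

/-- The element `W·e_l` of `L²(S¹)`. -/
def WeL2 (l : ℤ) : CircleL2 :=
  ContinuousMap.toLp 2 AddCircle.haarAddCircle ℂ (Wfun * fourier l)

/-- `P` is the Szegő (Hardy) projection: the (unique) bounded operator fixing `e_n` for
`n ≥ 0` and annihilating `e_n` for `n < 0`. -/
def IsSzegoProjection (P : CircleL2 →L[ℂ] CircleL2) : Prop :=
  ∀ n : ℤ, P (fourierLp 2 n) = if 0 ≤ n then fourierLp 2 n else 0

/-- `MW` is the bounded operator of multiplication by `W`: the (unique) bounded operator
sending (the class of) a continuous function `g` to (the class of) `W·g`. -/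
def IsWMultiplication (MW : CircleL2 →L[ℂ] CircleL2) : Prop :=
  ∀ g : C(AddCircle (2 * Real.pi), ℂ),
    MW (ContinuousMap.toLp 2 AddCircle.haarAddCircle ℂ g)
      = ContinuousMap.toLp 2 AddCircle.haarAddCircle ℂ (Wfun * g)

/-- The commutator vector `g_l := (P M_W − M_W P)(W·e_l)`. -/
def commVec (P MW : CircleL2 →L[ℂ] CircleL2) (l : ℕ) : CircleL2 :=
  P (MW (WeL2 l)) - MW (P (WeL2 l))

/-- If a family on a product is summable, then its sum can be computed as an iterated sum, first
over the first coordinate. -/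
lemma hasSum_of_iterated_swap {E : Type*} [NormedAddCommGroup E] [CompleteSpace E]
    {α β : Type*} {f : α × β → E} {g : β → E} {v : E} (hf : Summable f)
    (hfg : ∀ b, HasSum (fun a => f (a, b)) (g b)) (hg : HasSum g v) : HasSum f v := by
  have hswap : Summable (fun q : β × α => f q.swap) := (Equiv.prodComm β α).summable_iff.mpr hf
  have h := (hswap.hasSum.prod_fiberwise hfg).unique hg
  exact (Equiv.prodComm β α).hasSum_iff.mp (h ▸ hswap.hasSum)

/-- The squared norm of an absolutely convergent combination, with possible repetitions, of the
members of an orthonormal family. -/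
lemma Orthonormal.hasSum_norm_sq {H : Type*} [NormedAddCommGroup H] [InnerProductSpace ℂ H]
    {ι α : Type*} [DecidableEq ι] {e : ι → H} (he : Orthonormal ℂ e) {k : α → ι} {c : α → ℝ}
    (hc : Summable (fun a => ‖c a‖)) {v : H} (hv : HasSum (fun a => (c a : ℂ) • e (k a)) v) :
    HasSum (fun q : α × α => if k q.1 = k q.2 then c q.1 * c q.2 else 0) (‖v‖ ^ 2) := by
  have hsum : Summable (fun q : α × α => if k q.1 = k q.2 then c q.1 * c q.2 else 0) := by
    refine Summable.of_norm_bounded (hc.mul_of_nonneg hc (fun _ => norm_nonneg _)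
      fun _ => norm_nonneg _) fun q => ?_
    split_ifs
    · rw [norm_mul]
    · simpa using by positivity
  refine hasSum_of_iterated_swap (g := fun b => (inner ℂ v ((c b : ℂ) • e (k b))).re) hsum
    (fun b => ?_) ?_
  · have hterm : ∀ a, (innerSL ℂ ((c b : ℂ) • e (k b)) ((c a : ℂ) • e (k a))).re =
        if k a = k b then c a * c b else 0 := fun a => by
      rw [innerSL_apply_apply, inner_smul_left, inner_smul_right, orthonormal_iff_ite.mp he]
      by_cases hab : k a = k b
      · simp [hab, mul_comm]
      · simp [hab, Ne.symm hab]
    have h := Complex.hasSum_re ((innerSL ℂ ((c b : ℂ) • e (k b))).hasSum hv)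
    simp only [hterm] at h
    rwa [← inner_conj_symm, Complex.conj_re]
  · have h := Complex.hasSum_re ((innerSL ℂ v).hasSum hv)
    rw [innerSL_apply_apply, inner_self_eq_norm_sq_to_K] at h
    simpa [← Complex.ofReal_pow] using h

/-- The coefficient `2^{-n/4}` of `W`. -/
def wCoeff (n : ℕ) : ℝ := (2 : ℝ) ^ (-(n : ℝ) / 4)

lemma wCoeff_pos (n : ℕ) : 0 < wCoeff n := by unfold wCoeff; positivity

lemma summable_wCoeff : Summable wCoeff := by
  have h : wCoeff = fun n : ℕ => ((2 : ℝ) ^ (-(1 / 4) : ℝ)) ^ n := by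
    funext n
    rw [wCoeff, ← Real.rpow_natCast, ← Real.rpow_mul (by norm_num)]
    ring_nf
  rw [h]
  exact summable_geometric_of_lt_one (by positivity)
    (Real.rpow_lt_one_of_one_lt_of_neg (by norm_num) (by norm_num))

lemma hasSum_Wfun : HasSum (fun n : ℕ => (wCoeff n : ℂ) •
    (fourier (T := 2 * Real.pi) (2 ^ n) + fourier (-(2 ^ n : ℤ)))) Wfun := by
  refine Summable.hasSum (Summable.of_norm_bounded (summable_wCoeff.mul_right 2) fun n => ?_)
  rw [norm_smul, Complex.norm_real, Real.norm_of_nonneg (wCoeff_pos n).le]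
  refine mul_le_mul_of_nonneg_left ?_ (wCoeff_pos n).le
  refine (norm_add_le _ _).trans ?_
  rw [fourier_norm, fourier_norm]
  norm_num

/-- The Fourier expansion of `W·e_j` in `L²(S¹)`. -/
lemma hasSum_WeL2 (j : ℤ) : HasSum (fun n : ℕ => (wCoeff n : ℂ) •
    ((fourierLp 2 (2 ^ n + j) : CircleL2) + fourierLp 2 (-(2 ^ n : ℤ) + j))) (WeL2 j) := by
  have h := (ContinuousMap.toLp (E := ℂ) 2 (@AddCircle.haarAddCircle (2 * Real.pi) _) ℂ).hasSum
    (hasSum_Wfun.mul_right (fourier j))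
  rw [WeL2]
  convert h using 2 with n
  have hmul : ∀ i : ℤ, (fourier (T := 2 * Real.pi) i) * fourier j = fourier (i + j) := fun i => by
    ext x
    exact fourier_add.symm
  rw [smul_mul_assoc, add_mul, hmul, hmul, map_smul, map_add]

lemma hasSum_sub_szego_WeL2 {P : CircleL2 →L[ℂ] CircleL2} (hP : IsSzegoProjection P) (l : ℕ) :
    HasSum (fun m : ℕ => if (l : ℤ) + 1 ≤ 2 ^ m then
      (wCoeff m : ℂ) • (fourierLp 2 (-(2 ^ m : ℤ) + l) : CircleL2) else 0)
      (WeL2 l - P (WeL2 l)) := by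
  convert (hasSum_WeL2 l).sub (P.hasSum (hasSum_WeL2 l)) using 2 with m
  have h₀ : (0 : ℤ) ≤ 2 ^ m + l := by positivity
  rw [map_smul, map_add, hP, hP, if_pos h₀, ← smul_sub]
  split_ifs
  · omega
  · simp
  · simp
  · omega

lemma hasSum_szego_WeL2 {P : CircleL2 →L[ℂ] CircleL2} (hP : IsSzegoProjection P) {j : ℤ}
    (hj : j < 0) :
    HasSum (fun n : ℕ => if -j ≤ 2 ^ n then
      (wCoeff n : ℂ) • (fourierLp 2 (2 ^ n + j) : CircleL2) else 0) (P (WeL2 j)) := by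
  convert P.hasSum (hasSum_WeL2 j) using 2 with n
  have h₀ : (0 : ℤ) < 2 ^ n := by positivity
  rw [map_smul, map_add, hP, hP, if_neg (show ¬ 0 ≤ -(2 ^ n : ℤ) + j by omega), add_zero]
  split_ifs
  · rfl
  · omega
  · omega
  · simp

lemma szego_commVec (P MW : CircleL2 →L[ℂ] CircleL2) (hP : IsSzegoProjection P) (l : ℕ) :
    P (commVec P MW l) = P (MW (WeL2 l - P (WeL2 l))) := by
  have hPP : P ∘L P = P := by
    refine ContinuousLinearMap.ext_on
      (Submodule.dense_iff_topologicalClosure_eq_top.mpr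
        (span_fourierLp_closure_eq_top (T := 2 * Real.pi) (p := 2) (by norm_num))) ?_
    rintro _ ⟨n, rfl⟩
    rw [ContinuousLinearMap.comp_apply, hP]
    split_ifs with hn
    · rw [hP, if_pos hn]
    · rw [map_zero]
  have h := DFunLike.congr_fun hPP (MW (WeL2 l))
  rw [ContinuousLinearMap.comp_apply] at h
  rw [commVec, map_sub, map_sub, map_sub, h]

/-- The coefficient of the pair `p = (n, m)` in the expansion of `P g_l`. -/
def pairCoeff (l : ℕ) (p : ℕ × ℕ) : ℝ :=
  if (l : ℤ) + 1 ≤ 2 ^ p.2 ∧ (2 : ℤ) ^ p.2 - l ≤ 2 ^ p.1 then wCoeff p.1 * wCoeff p.2 else 0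

lemma summable_norm_pairCoeff (l : ℕ) : Summable fun p => ‖pairCoeff l p‖ := by
  have hw : ∀ n, 0 ≤ wCoeff n := fun n => (wCoeff_pos n).le
  refine Summable.of_nonneg_of_le (fun _ => norm_nonneg _) (fun p => ?_)
    (summable_wCoeff.mul_of_nonneg summable_wCoeff hw hw)
  have hp := mul_nonneg (hw p.1) (hw p.2)
  unfold pairCoeff
  split_ifs
  · rw [Real.norm_of_nonneg hp]
  · simpa using hp

lemma hasSum_szego_commVec {P MW : CircleL2 →L[ℂ] CircleL2} (hP : IsSzegoProjection P)
    (hMW : IsWMultiplication MW) (l : ℕ) :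
    HasSum (fun p : ℕ × ℕ => (pairCoeff l p : ℂ) •
      (fourierLp 2 ((2 : ℤ) ^ p.1 + (-(2 ^ p.2 : ℤ) + l)) : CircleL2)) (P (commVec P MW l)) := by
  rw [szego_commVec P MW hP]
  refine hasSum_of_iterated_swap ?_ (fun m => ?_)
    (P.hasSum (MW.hasSum (hasSum_sub_szego_WeL2 hP l)))
  · refine Summable.of_norm ((summable_norm_pairCoeff l).congr fun p => ?_)
    rw [norm_smul, orthonormal_fourier.norm_eq_one, mul_one, Complex.norm_real]
  · by_cases hm : (l : ℤ) + 1 ≤ 2 ^ m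
    · have hMWe : MW (fourierLp 2 (-(2 ^ m : ℤ) + l)) = WeL2 (-(2 ^ m : ℤ) + l) := hMW _
      rw [if_pos hm, map_smul, map_smul, hMWe]
      convert (hasSum_szego_WeL2 hP (j := -(2 ^ m : ℤ) + l) (by omega)).const_smul
        (wCoeff m : ℂ) using 2 with n
      have hiff : (2 : ℤ) ^ m - l ≤ 2 ^ n ↔ -(-(2 ^ m : ℤ) + l) ≤ 2 ^ n := by
        constructor <;> intro <;> omega
      simp only [pairCoeff, hm, true_and, hiff]
      split_ifs
      · rw [smul_smul, Complex.ofReal_mul, mul_comm (wCoeff m : ℂ)]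
      · simp
    · simp [pairCoeff, hm]

lemma wCoeff_mul_mul_mul (n m n' m' : ℕ) :
    wCoeff n * wCoeff m * (wCoeff n' * wCoeff m') =
      (2 : ℝ) ^ (-((n : ℝ) + (n' : ℝ) + (m : ℝ) + (m' : ℝ)) / 4) := by
  simp only [wCoeff]
  rw [← Real.rpow_add two_pos, ← Real.rpow_add two_pos, ← Real.rpow_add two_pos]
  ring_nf

/-- Norm identity for the projected commutator vector: for every integer
`l ≥ 0`, `‖P g_l‖² = Σ_{(n,m,n',m') ∈ Γ_l} 2^{-(n+n'+m+m')/4}` where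
`Γ_l = {(n,m,n',m') ∈ ℕ⁴ : 2^m ≥ l+1, 2^{m'} ≥ l+1, 2^n ≥ 2^m − l, 2^{n'} ≥ 2^{m'} − l,
2^n − 2^m = 2^{n'} − 2^{m'}}`, the sum converging absolutely (it is a `HasSum` of
nonnegative terms). Here a quadruple is encoded as `q = ((n, m), (n', m'))`. -/
theorem statement17 (P MW : CircleL2 →L[ℂ] CircleL2)
    (hP : IsSzegoProjection P) (hMW : IsWMultiplication MW) (l : ℕ) :
    HasSum (fun q : {q : (ℕ × ℕ) × (ℕ × ℕ) //
        (l : ℤ) + 1 ≤ 2 ^ q.1.2 ∧ (l : ℤ) + 1 ≤ 2 ^ q.2.2 ∧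
        (2 : ℤ) ^ q.1.2 - l ≤ 2 ^ q.1.1 ∧ (2 : ℤ) ^ q.2.2 - l ≤ 2 ^ q.2.1 ∧
        (2 : ℤ) ^ q.1.1 - 2 ^ q.1.2 = (2 : ℤ) ^ q.2.1 - 2 ^ q.2.2} =>
      (2 : ℝ) ^ (-((q.1.1.1 : ℝ) + (q.1.2.1 : ℝ) + (q.1.1.2 : ℝ) + (q.1.2.2 : ℝ)) / 4))
      (‖P (commVec P MW l)‖ ^ 2) := by
  refine (hasSum_subtype_iff_indicator (f := fun q : (ℕ × ℕ) × (ℕ × ℕ) =>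
    (2 : ℝ) ^ (-((q.1.1 : ℝ) + (q.2.1 : ℝ) + (q.1.2 : ℝ) + (q.2.2 : ℝ)) / 4))
    (s := {q | (l : ℤ) + 1 ≤ 2 ^ q.1.2 ∧ (l : ℤ) + 1 ≤ 2 ^ q.2.2 ∧
      (2 : ℤ) ^ q.1.2 - l ≤ 2 ^ q.1.1 ∧ (2 : ℤ) ^ q.2.2 - l ≤ 2 ^ q.2.1 ∧
      (2 : ℤ) ^ q.1.1 - 2 ^ q.1.2 = (2 : ℤ) ^ q.2.1 - 2 ^ q.2.2})).mpr ?_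
  convert (orthonormal_fourier (T := 2 * Real.pi)).hasSum_norm_sq (summable_norm_pairCoeff l)
    (hasSum_szego_commVec hP hMW l) using 2 with q
  obtain ⟨⟨n, m⟩, ⟨n', m'⟩⟩ := q
  have hiff : (2 : ℤ) ^ n + (-(2 ^ m : ℤ) + l) = 2 ^ n' + (-(2 ^ m' : ℤ) + l) ↔
      (2 : ℤ) ^ n - 2 ^ m = 2 ^ n' - 2 ^ m' := by
    constructor <;> intro <;> omega
  simp only [Set.indicator_apply, Set.mem_ofPred_eq, pairCoeff, hiff, ← wCoeff_mul_mul_mul]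
  split_ifs <;> simp_all
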